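/- arXiv:1305.2757 — 2 statements merged into one kernel-verified Lean document; each statement's English description precedes it below -/
import Mathlib

section
/- Let G be a group, N a normal subgroup of G, and ψ : G → ℝ a homogeneous quasi-morphism with ψ(n) = 0 for all n ∈ N. Then ψ(gn) = ψ(g) for every g ∈ G and n ∈ N; in particular ψ descends to a well-defined function on the quotient group G/N, and this induced function is a homogeneous quasi-morphism on G/N. -/
/-- A real number all of whose natural multiples are bounded in absolute value by the same
constant is zero. -/
lemma eq_zero_of_forall_natCast_mul_abs_le {x C : ℝ} (h : ∀ k : ℕ, (k : ℝ) * |x| ≤ C) :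
    x = 0 := by
  by_contra hx
  obtain ⟨k, hk⟩ := exists_nat_gt (C / |x|)
  rw [div_lt_iff₀ (abs_pos.mpr hx)] at hk
  exact absurd (h k) (not_le.mpr hk)

/-- A homogeneous quasi-morphism `ψ : G → ℝ` vanishing on a normal subgroup `N`
is invariant under right multiplication by elements of `N`; in particular it descends
to a well-defined function on `G ⧸ N`, which is again a homogeneous quasi-morphism. -/
theorem homogeneous_qm_descends_to_quotient
    {G : Type*} [Group G] (N : Subgroup G) [N.Normal] (ψ : G → ℝ)
    (hqm : ∃ C : ℝ, 0 ≤ C ∧ ∀ g g' : G, |ψ (g * g') - ψ g - ψ g'| ≤ C)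
    (hhom : ∀ (n : ℤ) (g : G), ψ (g ^ n) = n * ψ g)
    (hvanish : ∀ n ∈ N, ψ n = 0) :
    (∀ g : G, ∀ n ∈ N, ψ (g * n) = ψ g) ∧
    ∃ ψbar : G ⧸ N → ℝ,
      (∀ g : G, ψbar (QuotientGroup.mk g) = ψ g) ∧
      (∃ C : ℝ, 0 ≤ C ∧ ∀ a b : G ⧸ N, |ψbar (a * b) - ψbar a - ψbar b| ≤ C) ∧
      (∀ (n : ℤ) (a : G ⧸ N), ψbar (a ^ n) = n * ψbar a) := by
  obtain ⟨C, hC, hqm⟩ := hqm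
  have hinv : ∀ g : G, ∀ n ∈ N, ψ (g * n) = ψ g := by
    intro g n hn
    refine sub_eq_zero.mp (eq_zero_of_forall_natCast_mul_abs_le (C := C) fun k => ?_)
    have hm : (g ^ (k : ℤ))⁻¹ * (g * n) ^ (k : ℤ) ∈ N := by
      rw [← QuotientGroup.eq, QuotientGroup.mk_zpow, QuotientGroup.mk_zpow,
        QuotientGroup.mk_mul_of_mem g hn]
    have h := hqm (g ^ (k : ℤ)) ((g ^ (k : ℤ))⁻¹ * (g * n) ^ (k : ℤ))
    rw [mul_inv_cancel_left, hvanish _ hm, hhom, hhom, sub_zero, ← mul_sub, abs_mul] at h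
    simpa using h
  refine ⟨hinv, Quotient.lift ψ fun a b hab => ?_, fun g => rfl, ⟨C, hC, fun a b => ?_⟩,
    fun n a => ?_⟩
  · rw [← hinv a _ (QuotientGroup.leftRel_apply.mp hab), mul_inv_cancel_left]
  · induction a using QuotientGroup.induction_on
    induction b using QuotientGroup.induction_on
    exact hqm _ _
  · induction a using QuotientGroup.induction_on
    exact hhom n _
end

section
/- Let G be a group generated by a symmetric, conjugation-invariant subset A ⊆ G, and for f ∈ G let ‖f‖_A denote the word norm, i.e. the minimal m such that f is a product of m elements of A. Suppose ψ : G → ℝ is a homogeneous quasi-morphism with defect D_ψ > 0 which vanishes on A, and suppose ψ(f) ≠ 0 for some f ∈ G. Then for every natural number n one has ‖fⁿ‖_A ≥ n·|ψ(f)|/D_ψ; in particular, the word norm ‖·‖_A is unbounded on G. -/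
/-- The deviation of a quasi-morphism from additivity is bounded by its defect. -/
theorem abs_sub_sub_le_sInf_defect {G : Type*} [Group G] (ψ : G → ℝ)
    (hqm : ∃ C : ℝ, 0 ≤ C ∧ ∀ g g' : G, |ψ (g * g') - ψ g - ψ g'| ≤ C) (g g' : G) :
    |ψ (g * g') - ψ g - ψ g'| ≤
      sInf {C : ℝ | 0 ≤ C ∧ ∀ g g' : G, |ψ (g * g') - ψ g - ψ g'| ≤ C} :=
  le_csInf hqm fun _ hC => hC.2 g g'

/-- A quasi-morphism that vanishes at `1` and on the entries of a list is bounded on the product of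
the list by the defect times the length. -/
theorem abs_list_prod_le_length_mul {G : Type*} [Group G] {ψ : G → ℝ} {D : ℝ}
    (hD : ∀ g g' : G, |ψ (g * g') - ψ g - ψ g'| ≤ D) (hone : ψ 1 = 0) (L : List G)
    (hL : ∀ x ∈ L, ψ x = 0) : |ψ L.prod| ≤ L.length * D := by
  induction L with
  | nil => simp [hone]
  | cons x L ih =>
    have hx : ψ x = 0 := hL x (by simp)
    have ih' := abs_le.mp (ih fun y hy => hL y (by simp [hy]))
    have h := abs_le.mp (hD x L.prod)
    rw [List.prod_cons, List.length_cons, abs_le]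
    push_cast
    constructor <;> linarith [h.1, h.2, ih'.1, ih'.2]

/-- Every element of a group generated by a symmetric set is a product of elements of that set. -/
theorem exists_list_prod_eq_of_closure_eq_top {G : Type*} [Group G] {A : Set G}
    (hsymm : A = A⁻¹) (hgen : Subgroup.closure A = ⊤) (g : G) :
    ∃ L : List G, (∀ x ∈ L, x ∈ A) ∧ L.prod = g := by
  apply Submonoid.exists_list_of_mem_closure
  have h := Subgroup.closure_toSubmonoid A
  rw [← hsymm, Set.union_self, hgen] at h
  rw [← h]
  exact Subgroup.mem_top g

/-- If `G` is generated by a symmetric conjugation-invariant set `A`, and a homogeneous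
quasi-morphism `ψ : G → ℝ` with defect `D > 0` vanishes on `A` but `ψ f ≠ 0` for some `f`,
then the word norm satisfies `‖f ^ n‖_A ≥ n * |ψ f| / D` for all `n`; in particular the
word norm is unbounded on `G`. -/
theorem homogeneous_qm_implies_unbounded_word_norm
    {G : Type*} [Group G] (A : Set G) (ψ : G → ℝ) (D : ℝ) (ν : G → ℕ)
    (hsymm : A = A⁻¹)
    (hconj : ∀ a ∈ A, ∀ g : G, g * a * g⁻¹ ∈ A)
    (hgen : Subgroup.closure A = ⊤)
    (hν : ∀ g : G,
      ν g = sInf {m : ℕ | ∃ L : List G, (∀ x ∈ L, x ∈ A) ∧ L.length = m ∧ L.prod = g})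
    (hqm : ∃ C : ℝ, 0 ≤ C ∧ ∀ g g' : G, |ψ (g * g') - ψ g - ψ g'| ≤ C)
    (hD : D = sInf {C : ℝ | 0 ≤ C ∧ ∀ g g' : G, |ψ (g * g') - ψ g - ψ g'| ≤ C})
    (hDpos : 0 < D)
    (hhom : ∀ (n : ℤ) (g : G), ψ (g ^ n) = n * ψ g)
    (hvanish : ∀ a ∈ A, ψ a = 0)
    (f : G) (hf : ψ f ≠ 0) :
    (∀ n : ℕ, (n : ℝ) * |ψ f| / D ≤ (ν (f ^ n) : ℝ)) ∧
    (∀ M : ℝ, ∃ g : G, M < (ν g : ℝ)) := by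
  have hdef : ∀ g g' : G, |ψ (g * g') - ψ g - ψ g'| ≤ D :=
    fun g g' => hD ▸ abs_sub_sub_le_sInf_defect ψ hqm g g'
  have hone : ψ 1 = 0 := by simpa using hhom 0 1
  have hbound : ∀ g : G, |ψ g| ≤ ν g * D := by
    intro g
    obtain ⟨L₀, hL₀, hprod₀⟩ := exists_list_prod_eq_of_closure_eq_top hsymm hgen g
    have hmem := Nat.sInf_mem (s := {m : ℕ | ∃ L : List G,
      (∀ x ∈ L, x ∈ A) ∧ L.length = m ∧ L.prod = g}) ⟨L₀.length, L₀, hL₀, rfl, hprod₀⟩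
    rw [← hν g] at hmem
    obtain ⟨L, hL, hlen, hprod⟩ := hmem
    rw [← hlen, ← hprod]
    exact abs_list_prod_le_length_mul hdef hone L fun x hx => hvanish x (hL x hx)
  have hpow : ∀ n : ℕ, (n : ℝ) * |ψ f| / D ≤ (ν (f ^ n) : ℝ) := by
    intro n
    have hn : ψ (f ^ n) = n * ψ f := by simpa using hhom n f
    rw [div_le_iff₀ hDpos]
    simpa [hn, abs_mul] using hbound (f ^ n)
  refine ⟨hpow, fun M => ?_⟩
  obtain ⟨n, hn⟩ := exists_nat_gt (M * D / |ψ f|)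
  refine ⟨f ^ n, lt_of_lt_of_le ?_ (hpow n)⟩
  rwa [lt_div_iff₀ hDpos, ← div_lt_iff₀ (abs_pos.mpr hf)]
end
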